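/- Let (E, L, τ) and (F, M, υ) be orthogonal isodual Euclidean lattices such that both b_τ and b_υ are definite. Then (E, L), (F, M), and the tensor product of (E, L) and (F, M) are all semistable. -/

import Mathlib

open Module

noncomputable section

namespace EucLat

variable {E : Type*} [NormedAddCommGroup E] [InnerProductSpace ℝ E]

/-- The covolume of a `ℤ`-submodule of a real inner product space: the square root of the
Gram determinant of a `ℤ`-basis (junk value `0` if no finite basis exists). -/
def covol (L : Submodule ℤ E) : ℝ :=
  @dite _ (∃ n : ℕ, Nonempty (Basis (Fin n) ℤ L)) (Classical.propDecidable _)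
    (fun h => Real.sqrt (Matrix.det (Matrix.of fun i j =>
      (inner ℝ ((h.choose_spec.some i : L) : E) ((h.choose_spec.some j : L) : E) : ℝ))))
    (fun _ => 0)

/-- The reduced height `covol(L)^(1/dim E)` of a full lattice. -/
def redH (L : Submodule ℤ E) : ℝ := covol L ^ ((finrank ℝ E : ℝ)⁻¹)

/-- The lattice `L ∩ F` induced on a subspace `F`. -/
def latIn (L : Submodule ℤ E) (F : Submodule ℝ E) : Submodule ℤ F :=
  L.comap (F.subtype.restrictScalars ℤ)

/-- The reduced height of a subspace: `covol(F ∩ L)^(1/dim F)`. -/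
def Hr (L : Submodule ℤ E) (F : Submodule ℝ E) : ℝ := redH (latIn L F)

/-- A subspace is rational if it is spanned by its intersection with the lattice. -/
def IsRational (L : Submodule ℤ E) (F : Submodule ℝ E) : Prop :=
  Submodule.span ℝ ((L : Set E) ∩ (F : Set E)) = F

/-- `(E, L)` is a Euclidean lattice: `L` is discrete and spans `E` over `ℝ`. -/
def IsLat (L : Submodule ℤ E) : Prop :=
  DiscreteTopology L ∧ Submodule.span ℝ (L : Set E) = ⊤

/-- Minimal reduced height: infimum of reduced heights of nonzero rational subspaces. -/
def Hmin (L : Submodule ℤ E) : ℝ :=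
  sInf {h : ℝ | ∃ F : Submodule ℝ E, F ≠ ⊥ ∧ IsRational L F ∧ h = Hr L F}

/-- Semistability of a Euclidean lattice. -/
def Semistable (L : Submodule ℤ E) : Prop :=
  ∀ F : Submodule ℝ E, F ≠ ⊥ → IsRational L F → redH L ≤ Hr L F

/-- Stability of a Euclidean lattice. -/
def Stable (L : Submodule ℤ E) : Prop :=
  Semistable L ∧ ∀ F : Submodule ℝ E, F ≠ ⊥ → F ≠ ⊤ → IsRational L F → redH L < Hr L F

/-- The quotient lattice of `(E, L)` by a subspace `F`: the image of `L` under the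
orthogonal projection of `E` onto `Fᗮ`. -/
def quotLat [FiniteDimensional ℝ E] (L : Submodule ℤ E) (F : Submodule ℝ E) :
    Submodule ℤ Fᗮ :=
  L.map ((Submodule.orthogonalProjectionOnto Fᗮ : E →ₗ[ℝ] Fᗮ).restrictScalars ℤ)

/-- For subspaces `F ≤ F'`, the successive quotient lattice: the image of `F' ∩ L` under the
orthogonal projection of `F'` onto the orthogonal complement of `F` inside `F'`. -/
def succQuot [FiniteDimensional ℝ E] (L : Submodule ℤ E) (F F' : Submodule ℝ E) :
    Submodule ℤ ((F.comap F'.subtype)ᗮ) :=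
  quotLat (latIn L F') (F.comap F'.subtype)

/-- A GS-flag of `(E, L)`. -/
def IsGSFlag [FiniteDimensional ℝ E] (L : Submodule ℤ E) {ℓ : ℕ}
    (C : Fin (ℓ + 1) → Submodule ℝ E) : Prop :=
  C 0 = ⊥ ∧ C (Fin.last ℓ) = ⊤ ∧
  (∀ i : Fin ℓ, C i.castSucc < C i.succ) ∧
  (∀ i, IsRational L (C i)) ∧
  (∀ i : Fin ℓ, Semistable (succQuot L (C i.castSucc) (C i.succ))) ∧
  (∀ i j : Fin ℓ, i < j →
    redH (succQuot L (C i.castSucc) (C i.succ)) < redH (succQuot L (C j.castSucc) (C j.succ)))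

/-- The dual lattice `L* = {y : ⟪x, y⟫ ∈ ℤ for all x ∈ L}`. -/
def dualLat (L : Submodule ℤ E) : Submodule ℤ E where
  carrier := {y | ∀ x ∈ L, ∃ n : ℤ, (inner ℝ x y : ℝ) = n}
  zero_mem' := fun x _ => ⟨0, by simp⟩
  add_mem' := by
    intro a b ha hb x hx
    obtain ⟨m, hm⟩ := ha x hx
    obtain ⟨n, hn⟩ := hb x hx
    exact ⟨m + n, by rw [inner_add_right, hm, hn]; push_cast; ring⟩
  smul_mem' := by
    intro z y hy x hx
    obtain ⟨n, hn⟩ := hy x hx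
    refine ⟨z * n, ?_⟩
    rw [← Int.cast_smul_eq_zsmul ℝ, real_inner_smul_right, hn]
    push_cast; ring

/-- `(E, L)` is isodual via the similarity `τ`. -/
def IsIsodual (L : Submodule ℤ E) (τ : E →ₗ[ℝ] E) : Prop :=
  (∃ α : ℝ, 0 < α ∧ ∀ x y : E, (inner ℝ (τ x) (τ y) : ℝ) = α * inner ℝ x y) ∧
  L.map (τ.restrictScalars ℤ) = dualLat L

/-- The bilinear form `b_τ(x, y) = ⟪τ x, y⟫` associated with an isoduality. -/
def bform (τ : E →ₗ[ℝ] E) (x y : E) : ℝ := inner ℝ (τ x) y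

/-- `b` has signature `s`: there is a `b`-orthogonal basis with `p - q = s`. -/
def HasSignature (b : E → E → ℝ) (s : ℤ) : Prop :=
  ∃ (n : ℕ) (v : Basis (Fin n) ℝ E),
    (∀ i j, i ≠ j → b (v i) (v j) = 0) ∧
    s = ((Finset.univ.filter fun i => 0 < b (v i) (v i)).card : ℤ) -
        ((Finset.univ.filter fun i => b (v i) (v i) < 0).card : ℤ)

/-- The destabilizing subspace of `(E, L)`. -/
def IsDestabilizing (L : Submodule ℤ E) (F : Submodule ℝ E) : Prop :=
  F ≠ ⊥ ∧ IsRational L F ∧ Hr L F = Hmin L ∧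
  ∀ F' : Submodule ℝ E, F' ≠ ⊥ → IsRational L F' → Hr L F' = Hmin L → F' ≤ F

/-- `(G, t)` is a realization of the tensor product of the inner product spaces `E` and `F`:
`t` induces a linear isomorphism `E ⊗ F ≃ G` and
`⟪t x y, t x' y'⟫ = ⟪x, x'⟫ * ⟪y, y'⟫` on pure tensors. -/
def IsTensor {F G : Type*} [NormedAddCommGroup F] [InnerProductSpace ℝ F]
    [NormedAddCommGroup G] [InnerProductSpace ℝ G] (t : E →ₗ[ℝ] F →ₗ[ℝ] G) : Prop :=
  Function.Bijective (TensorProduct.lift t) ∧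
  ∀ (x x' : E) (y y' : F),
    (inner ℝ (t x y) (t x' y') : ℝ) = (inner ℝ x x' : ℝ) * (inner ℝ y y' : ℝ)

/-- The tensor product lattice `L·M`: the additive subgroup generated by pure tensors. -/
def tensorLat {F G : Type*} [NormedAddCommGroup F] [InnerProductSpace ℝ F]
    [NormedAddCommGroup G] [InnerProductSpace ℝ G] (t : E →ₗ[ℝ] F →ₗ[ℝ] G)
    (L : Submodule ℤ E) (M : Submodule ℤ F) : Submodule ℤ G :=
  Submodule.span ℤ (Set.image2 (fun x y => t x y) (L : Set E) (M : Set F))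

/-- `g` is an automorphism of the Euclidean lattice `(E, L)`. -/
def IsAut (L : Submodule ℤ E) (g : E ≃ₗ[ℝ] E) : Prop :=
  (∀ x, x ∈ L ↔ g x ∈ L) ∧ ∀ x y : E, (inner ℝ (g x) (g y) : ℝ) = inner ℝ x y

/-- The direct product lattice `L × L'` inside `WithLp 2 (E × E')`. -/
def prodLat {E' : Type*} [NormedAddCommGroup E'] [InnerProductSpace ℝ E']
    (L : Submodule ℤ E) (L' : Submodule ℤ E') : Submodule ℤ (WithLp 2 (E × E')) :=
  (L.prod L').comap (((WithLp.linearEquiv 2 ℝ (E × E')).restrictScalars ℤ) : WithLp 2 (E × E') →ₗ[ℤ] E × E')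


/-- `c⟪x, y⟫` is an integer for all `x, y` in the lattice. -/
def IntForm (c : ℝ) (L : Submodule ℤ E) : Prop :=
  ∀ x ∈ L, ∀ y ∈ L, ∃ n : ℤ, c * (inner ℝ x y : ℝ) = n

/-- The lattice contains its dual with respect to `c⟪x, y⟫`. -/
def SelfDual (c : ℝ) (L : Submodule ℤ E) : Prop :=
  ∀ z : E, (∀ x ∈ L, ∃ n : ℤ, c * (inner ℝ x z : ℝ) = n) → z ∈ L

lemma discrete_of_intForm {c : ℝ} (hc : 0 < c) {L : Submodule ℤ E} (h : IntForm c L) :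
    DiscreteTopology L := by
  have hr : 0 < Real.sqrt (c⁻¹) := Real.sqrt_pos.2 (inv_pos.2 hc)
  refine DiscreteTopology.of_forall_le_norm (E := L) hr ?_
  intro x hx
  obtain ⟨n, hn⟩ := h x x.2 x x.2
  have hx' : (x : E) ≠ 0 := by simpa using hx
  rw [real_inner_self_eq_norm_sq] at hn
  have hpos : 0 < c * ‖(x : E)‖ ^ 2 := mul_pos hc (pow_pos (norm_pos_iff.2 hx') 2)
  rw [hn] at hpos
  have h1 : (1 : ℝ) ≤ n := by exact_mod_cast hpos
  rw [← hn] at h1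
  show Real.sqrt (c⁻¹) ≤ ‖(x : E)‖
  apply Real.sqrt_le_iff.2 ⟨norm_nonneg _, ?_⟩
  rw [inv_le_iff_one_le_mul₀ hc]
  linarith

lemma covol_spec [FiniteDimensional ℝ E] {L : Submodule ℤ E} (hL : IsLat L) :
    ∃ (n : ℕ) (b : Basis (Fin n) ℤ L) (B : Basis (Fin n) ℝ E), n = finrank ℝ E ∧
      (∀ i, B i = (b i : E)) ∧ 0 < (Matrix.gram ℝ B).det ∧
      covol L = Real.sqrt (Matrix.gram ℝ B).det := by
  obtain ⟨hd, hs⟩ := hL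
  haveI : IsZLattice ℝ L := ⟨hs⟩
  haveI : Module.Finite ℤ L := ZLattice.module_finite ℝ L
  haveI : Module.Free ℤ L := ZLattice.module_free ℝ L
  have h : ∃ n : ℕ, Nonempty (Basis (Fin n) ℤ L) := ⟨_, ⟨Module.finBasis ℤ L⟩⟩
  let b := h.choose_spec.some
  let B := b.ofZLatticeBasis ℝ L
  have hB : ∀ i, B i = (b i : E) := fun i => b.ofZLatticeBasis_apply ℝ L i
  refine ⟨h.choose, b, B, ?_, hB, ?_, ?_⟩
  · rw [Module.finrank_eq_card_basis B, Fintype.card_fin]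
  · exact (Matrix.posDef_gram_of_linearIndependent B.linearIndependent).det_pos
  · rw [covol, dif_pos h]
    congr 2
    ext i j
    simp only [Matrix.of_apply, Matrix.gram_apply, hB]
    rfl

/-- Scaled Gram matrix is an integral matrix. -/
lemma exists_int_gram {c : ℝ} {L : Submodule ℤ E} (h : IntForm c L) {n : ℕ}
    (v : Fin n → E) (hv : ∀ i, v i ∈ L) :
    ∃ A : Matrix (Fin n) (Fin n) ℤ, (∀ i j, c * (inner ℝ (v i) (v j) : ℝ) = A i j) ∧
      c ^ n * (Matrix.gram ℝ v).det = (A.det : ℤ) := by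
  choose A hA using fun i j => h (v i) (hv i) (v j) (hv j)
  refine ⟨Matrix.of A, hA, ?_⟩
  have : c • Matrix.gram ℝ v = (Matrix.of A).map (Int.castRingHom ℝ) := by
    ext i j
    simp [hA]
  have h2 := congrArg Matrix.det this
  rw [Matrix.det_smul, Fintype.card_fin] at h2
  rw [h2]
  exact ((Int.castRingHom ℝ).map_det _).symm

lemma covol_lower [FiniteDimensional ℝ E] {L : Submodule ℤ E} (hL : IsLat L) {c : ℝ}
    (hc : 0 < c) (h : IntForm c L) : 1 ≤ c ^ finrank ℝ E * covol L ^ 2 := by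
  obtain ⟨n, b, B, hn, hB, hpos, hcov⟩ := covol_spec hL
  obtain ⟨A, hA, hdet⟩ := exists_int_gram h B (fun i => by rw [hB]; exact (b i).2)
  rw [hcov, Real.sq_sqrt hpos.le, ← hn, hdet]
  have : (0 : ℝ) < (A.det : ℤ) := by rw [← hdet]; positivity
  exact_mod_cast this

/-- Dual basis with respect to `c⟪x, y⟫`. -/
lemma exists_dual [FiniteDimensional ℝ E] {L : Submodule ℤ E} {c : ℝ} (hc : 0 < c)
    (hd : SelfDual c L) {n : ℕ} (b : Basis (Fin n) ℤ L) (B : Basis (Fin n) ℝ E)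
    (hB : ∀ i, B i = (b i : E)) :
    ∃ e : Fin n → E, (∀ i, e i ∈ L) ∧
      ∀ i j, c * (inner ℝ (B i) (e j) : ℝ) = if i = j then 1 else 0 := by
  let e : Fin n → E := fun j =>
    c⁻¹ • (InnerProductSpace.toDual ℝ E).symm (LinearMap.toContinuousLinearMap (B.coord j))
  have he : ∀ x j, c * (inner ℝ x (e j) : ℝ) = B.coord j x := by
    intro x j
    simp only [e]
    rw [real_inner_smul_right, real_inner_comm, InnerProductSpace.toDual_symm_apply,
      mul_inv_cancel_left₀ hc.ne']
    rfl
  have hbe : ∀ i j, c * (inner ℝ (B i) (e j) : ℝ) = if i = j then 1 else 0 := by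
    intro i j
    rw [he, Basis.coord_apply, Basis.repr_self, Finsupp.single_apply]
  refine ⟨e, fun j => hd _ fun x hx => ?_, hbe⟩
  refine ⟨b.repr ⟨x, hx⟩ j, ?_⟩
  have hx2 : x = ∑ i, ((b.repr ⟨x, hx⟩ i : ℤ) : ℝ) • B i := by
    have := congrArg (Subtype.val) (b.sum_repr ⟨x, hx⟩)
    simp only at this
    conv_lhs => rw [← this]
    rw [AddSubmonoidClass.coe_finset_sum]
    refine Finset.sum_congr rfl fun i _ => ?_
    rw [hB, Int.cast_smul_eq_zsmul]
    rfl
  conv_lhs => rw [hx2]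
  rw [sum_inner, Finset.mul_sum]
  simp only [real_inner_smul_left, mul_left_comm c, hbe]
  simp

lemma covol_upper [FiniteDimensional ℝ E] {L : Submodule ℤ E} (hL : IsLat L) {c : ℝ}
    (hc : 0 < c) (h : IntForm c L) (hd : SelfDual c L) :
    c ^ finrank ℝ E * covol L ^ 2 = 1 := by
  obtain ⟨n, b, B, hn, hB, hpos, hcov⟩ := covol_spec hL
  obtain ⟨A, hA, hdet⟩ := exists_int_gram h B (fun i => by rw [hB]; exact (b i).2)
  obtain ⟨e, he, hbe⟩ := exists_dual hc hd b B hB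
  have hAP : A * (Matrix.of fun k j => b.repr ⟨e j, he j⟩ k) = 1 := by
    ext i j
    rw [Matrix.mul_apply, Matrix.one_apply]
    have h1 := hbe i j
    have hx2 : e j = ∑ k, ((b.repr ⟨e j, he j⟩ k : ℤ) : ℝ) • B k := by
      have := congrArg (Subtype.val) (b.sum_repr ⟨e j, he j⟩)
      simp only at this
      conv_lhs => rw [← this]
      rw [AddSubmonoidClass.coe_finset_sum]
      refine Finset.sum_congr rfl fun k _ => ?_
      rw [hB, Int.cast_smul_eq_zsmul]
      rfl
    rw [hx2, inner_sum, Finset.mul_sum] at h1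
    simp only [real_inner_smul_right, mul_left_comm c, hA] at h1
    have h3 : ((∑ k, A i k * (b.repr ⟨e j, he j⟩ k) : ℤ) : ℝ) = ((if i = j then 1 else 0 : ℤ) : ℝ) := by
      push_cast
      rw [← h1]
      exact Finset.sum_congr rfl fun k _ => mul_comm _ _
    exact_mod_cast h3
  have hu : IsUnit A.det := by
    have := congrArg Matrix.det hAP
    rw [Matrix.det_mul, Matrix.det_one] at this
    exact IsUnit.of_mul_eq_one _ this
  have hp : (0 : ℝ) < (A.det : ℤ) := by rw [← hdet]; positivity
  have hp' : 0 < A.det := by exact_mod_cast hp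
  rw [hcov, Real.sq_sqrt hpos.le, ← hn, hdet]
  rcases Int.isUnit_iff.1 hu with h1 | h1
  · simp [h1]
  · omega

lemma covol_nonneg (L : Submodule ℤ E) : 0 ≤ covol L := by
  unfold covol
  split_ifs
  · exact Real.sqrt_nonneg _
  · exact le_rfl

lemma latIn_isLat {L : Submodule ℤ E} {c : ℝ} (hc : 0 < c) (h : IntForm c L)
    {F : Submodule ℝ E} (hF : IsRational L F) :
    IsLat (latIn L F) ∧ IntForm c (latIn L F) := by
  have hi : IntForm c (latIn L F) := fun x hx y hy => h x hx y hy
  refine ⟨⟨discrete_of_intForm hc hi, ?_⟩, hi⟩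
  apply Submodule.map_injective_of_injective F.injective_subtype
  rw [Submodule.map_span, Submodule.map_top, Submodule.range_subtype]
  conv_rhs => rw [← hF]
  congr 1
  ext x
  constructor
  · rintro ⟨y, hy, rfl⟩
    exact ⟨hy, y.2⟩
  · rintro ⟨h1, h2⟩
    exact ⟨⟨x, h2⟩, h1, rfl⟩

lemma sqrt_bound {c v : ℝ} (hc : 0 < c) (hv : 0 ≤ v) {n : ℕ} (hn : n ≠ 0)
    (h : 1 ≤ c ^ n * v ^ 2) : (Real.sqrt c)⁻¹ ≤ v ^ ((n : ℝ)⁻¹) := by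
  have hs : 0 < Real.sqrt c := Real.sqrt_pos.2 hc
  have h1 : 1 ≤ (Real.sqrt c ^ n * v) ^ 2 := by
    rw [mul_pow, ← pow_mul, mul_comm n 2, pow_mul, Real.sq_sqrt hc.le]
    exact h
  have h2 : 1 ≤ Real.sqrt c ^ n * v := by
    by_contra! hlt
    have : 0 ≤ Real.sqrt c ^ n * v := by positivity
    nlinarith
  have h3 : ((Real.sqrt c)⁻¹) ^ n ≤ v := by
    rw [inv_pow, inv_le_iff_one_le_mul₀ (by positivity)]
    linarith
  calc (Real.sqrt c)⁻¹ = (((Real.sqrt c)⁻¹) ^ n) ^ ((n : ℝ)⁻¹) :=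
        (Real.pow_rpow_inv_natCast (by positivity) hn).symm
    _ ≤ _ := Real.rpow_le_rpow (by positivity) h3 (by positivity)

lemma sqrt_eq {c v : ℝ} (hc : 0 < c) (hv : 0 ≤ v) {n : ℕ} (hn : n ≠ 0)
    (h : c ^ n * v ^ 2 = 1) : v ^ ((n : ℝ)⁻¹) = (Real.sqrt c)⁻¹ := by
  have hs : 0 < Real.sqrt c := Real.sqrt_pos.2 hc
  have h1 : (Real.sqrt c ^ n * v) ^ 2 = 1 := by
    rw [mul_pow, ← pow_mul, mul_comm n 2, pow_mul, Real.sq_sqrt hc.le]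
    exact h
  have h2 : Real.sqrt c ^ n * v = 1 := by
    rwa [pow_eq_one_iff_of_nonneg (by positivity) two_ne_zero] at h1
  have h3 : v = ((Real.sqrt c)⁻¹) ^ n := by
    rw [inv_pow]
    exact eq_inv_of_mul_eq_one_right h2
  rw [h3, Real.pow_rpow_inv_natCast (by positivity) hn]

lemma semistable_of_selfDual [FiniteDimensional ℝ E] {L : Submodule ℤ E}
    (hL : Submodule.span ℝ (L : Set E) = ⊤) {c : ℝ}
    (hc : 0 < c) (h : IntForm c L) (hd : SelfDual c L) : Semistable L := by
  intro F hF hr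
  obtain ⟨h1, h2⟩ := latIn_isLat hc h hr
  have hF0 : finrank ℝ F ≠ 0 := by rwa [Ne, Submodule.finrank_eq_zero]
  have hE0 : finrank ℝ E ≠ 0 := by
    have := Submodule.finrank_le F
    omega
  have hlat : IsLat L := ⟨discrete_of_intForm hc h, hL⟩
  unfold Hr redH
  rw [sqrt_eq hc (covol_nonneg L) hE0 (covol_upper hlat hc h hd)]
  exact sqrt_bound hc (covol_nonneg _) hF0 (covol_lower h1 hc h2)

lemma isodual_scalar {L : Submodule ℤ E} {τ : E →ₗ[ℝ] E} (hτ : IsIsodual L τ)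
    (hs : ∀ x y, bform τ x y = bform τ y x)
    (hdef : (∀ x : E, x ≠ 0 → 0 < bform τ x x) ∨ (∀ x : E, x ≠ 0 → bform τ x x < 0)) :
    ∃ c : ℝ, 0 < c ∧ IntForm c L ∧ SelfDual c L := by
  obtain ⟨⟨α, hα, hsim⟩, hmap⟩ := hτ
  have hsq : ∀ x, τ (τ x) = α • x := by
    intro x
    refine ext_inner_right ℝ fun y => ?_
    have := hs (τ x) y
    unfold bform at this
    rw [this, hsim, real_inner_smul_left, real_inner_comm]
  have hs0 : 0 < Real.sqrt α := Real.sqrt_pos.2 hα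
  have hss : Real.sqrt α * Real.sqrt α = α := Real.mul_self_sqrt hα.le
  have key : (∀ x, τ x = Real.sqrt α • x) ∨ (∀ x, τ x = -(Real.sqrt α • x)) := by
    rcases hdef with hp | hp
    · left
      intro x
      by_contra hne
      have hw : τ x - Real.sqrt α • x ≠ 0 := sub_ne_zero.2 hne
      have h1 := hp _ hw
      have h2 : τ (τ x - Real.sqrt α • x) = -(Real.sqrt α • (τ x - Real.sqrt α • x)) := by
        rw [map_sub, map_smul, hsq, smul_sub, smul_smul, hss]
        abel
      rw [bform, h2, inner_neg_left, real_inner_smul_left] at h1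
      have := mul_nonneg hs0.le (real_inner_self_nonneg (x := τ x - Real.sqrt α • x))
      linarith
    · right
      intro x
      by_contra hne
      have hw : τ x + Real.sqrt α • x ≠ 0 := fun h => hne (eq_neg_of_add_eq_zero_left h)
      have h1 := hp _ hw
      have h2 : τ (τ x + Real.sqrt α • x) = Real.sqrt α • (τ x + Real.sqrt α • x) := by
        rw [map_add, map_smul, hsq, smul_add, smul_smul, hss]
        abel
      rw [bform, h2, real_inner_smul_left] at h1
      have := mul_nonneg hs0.le (real_inner_self_nonneg (x := τ x + Real.sqrt α • x))
      linarith
  refine ⟨Real.sqrt α, hs0, ?_, ?_⟩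
  · intro x hx y hy
    have hm : τ y ∈ dualLat L := by
      rw [← hmap]
      exact ⟨y, hy, rfl⟩
    obtain ⟨n, hn⟩ := hm x hx
    rcases key with k | k
    · exact ⟨n, by rw [← hn, k, real_inner_smul_right]⟩
    · refine ⟨-n, ?_⟩
      rw [Int.cast_neg, ← hn, k, inner_neg_right, real_inner_smul_right, neg_neg]
  · intro z hz
    have hm : Real.sqrt α • z ∈ dualLat L := by
      intro x hx
      obtain ⟨n, hn⟩ := hz x hx
      exact ⟨n, by rw [← hn, real_inner_smul_right]⟩
    rw [← hmap] at hm
    obtain ⟨w, hw, hwz⟩ := hm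
    have hwz' : τ w = Real.sqrt α • z := hwz
    rcases key with k | k
    · rw [k] at hwz'
      rw [← smul_right_injective E hs0.ne' hwz']
      exact hw
    · rw [k, ← smul_neg] at hwz'
      rw [← smul_right_injective E hs0.ne' hwz']
      exact L.neg_mem hw

lemma tensor_facts {F G : Type*} [FiniteDimensional ℝ E] [NormedAddCommGroup F]
    [InnerProductSpace ℝ F] [FiniteDimensional ℝ F]
    [NormedAddCommGroup G] [InnerProductSpace ℝ G] {L : Submodule ℤ E} {M : Submodule ℤ F}
    (hL : IsLat L) (hM : IsLat M) {c d : ℝ} (hc : 0 < c) (hd : 0 < d)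
    (hcL : IntForm c L) (hdM : IntForm d M) (hcL' : SelfDual c L) (hdM' : SelfDual d M)
    {t : E →ₗ[ℝ] F →ₗ[ℝ] G} (ht : IsTensor t) :
    Submodule.span ℝ (tensorLat t L M : Set G) = ⊤ ∧ IntForm (c * d) (tensorLat t L M) ∧
      SelfDual (c * d) (tensorLat t L M) := by
  obtain ⟨hbij, hin⟩ := ht
  have hmem : ∀ x ∈ L, ∀ y ∈ M, t x y ∈ tensorLat t L M := fun x hx y hy =>
    Submodule.subset_span ⟨x, hx, y, hy, rfl⟩
  obtain ⟨n, b, B, -, hB, -, -⟩ := covol_spec hL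
  obtain ⟨m, b', B', -, hB', -, -⟩ := covol_spec hM
  obtain ⟨e, he, hbe⟩ := exists_dual hc hcL' b B hB
  obtain ⟨e', he', hbe'⟩ := exists_dual hd hdM' b' B' hB'
  let T : Basis (Fin n × Fin m) ℝ G :=
    (B.tensorProduct B').map (LinearEquiv.ofBijective _ hbij)
  have hT : ∀ i j, T (i, j) = t (B i) (B' j) := by
    intro i j
    simp [T]
  have hTm : ∀ p, T p ∈ tensorLat t L M := by
    rintro ⟨i, j⟩
    rw [hT, hB, hB']
    exact hmem _ (b i).2 _ (b' j).2
  refine ⟨?_, ?_, ?_⟩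
  · rw [eq_top_iff, ← T.span_eq]
    apply Submodule.span_mono
    rintro _ ⟨p, rfl⟩
    exact hTm p
  · intro x hx y hy
    induction hx using Submodule.span_induction with
    | zero => exact ⟨0, by simp⟩
    | add u v _ _ hu hv =>
      obtain ⟨p, hp⟩ := hu
      obtain ⟨q, hq⟩ := hv
      exact ⟨p + q, by rw [inner_add_left, mul_add, hp, hq]; push_cast; ring⟩
    | smul z u _ hu =>
      obtain ⟨p, hp⟩ := hu
      refine ⟨z * p, ?_⟩
      rw [← Int.cast_smul_eq_zsmul ℝ, real_inner_smul_left, mul_left_comm, hp]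
      push_cast; ring
    | mem u hu =>
      obtain ⟨x1, hx1, y1, hy1, rfl⟩ := hu
      induction hy using Submodule.span_induction with
      | zero => exact ⟨0, by simp⟩
      | add u v _ _ hu hv =>
        obtain ⟨p, hp⟩ := hu
        obtain ⟨q, hq⟩ := hv
        exact ⟨p + q, by rw [inner_add_right, mul_add, hp, hq]; push_cast; ring⟩
      | smul z u _ hu =>
        obtain ⟨p, hp⟩ := hu
        refine ⟨z * p, ?_⟩
        rw [← Int.cast_smul_eq_zsmul ℝ, real_inner_smul_right, mul_left_comm, hp]
        push_cast; ring
      | mem u hu =>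
        obtain ⟨x2, hx2, y2, hy2, rfl⟩ := hu
        obtain ⟨p, hp⟩ := hcL x1 hx1 x2 hx2
        obtain ⟨q, hq⟩ := hdM y1 hy1 y2 hy2
        refine ⟨p * q, ?_⟩
        simp only [hin]
        rw [Int.cast_mul, ← hp, ← hq]
        ring
  · intro z hz
    choose N hN using fun p => hz (T p) (hTm p)
    have hzz : z = ∑ p, N p • t (e p.1) (e' p.2) := by
      refine InnerProductSpace.ext_inner_left_basis T ?_
      rintro ⟨i, j⟩
      have hcd : c * d ≠ 0 := (mul_pos hc hd).ne'
      apply mul_left_cancel₀ hcd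
      rw [hN, inner_sum, Finset.mul_sum]
      have : ∀ p : Fin n × Fin m, c * d * (inner ℝ (T (i, j)) (N p • t (e p.1) (e' p.2)) : ℝ)
          = if (i, j) = p then (N p : ℝ) else 0 := by
        rintro ⟨k, l⟩
        rw [← Int.cast_smul_eq_zsmul ℝ, real_inner_smul_right, hT, hin]
        have : c * d * ((N (k, l) : ℝ) * ((inner ℝ (B i) (e k) : ℝ) * (inner ℝ (B' j) (e' l) : ℝ)))
            = N (k, l) * ((c * (inner ℝ (B i) (e k) : ℝ)) * (d * (inner ℝ (B' j) (e' l) : ℝ))) := by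
          ring
        rw [this, hbe, hbe']
        by_cases h1 : i = k <;> by_cases h2 : j = l <;> simp [h1, h2]
      simp only [this]
      simp
    rw [hzz]
    exact Submodule.sum_mem _ fun p _ => Submodule.smul_mem _ _ (hmem _ (he _) _ (he' _))

/-- If `(E, L, τ)` and `(F, M, υ)` are orthogonal isodual with `b_τ` and
`b_υ` definite, then `(E, L)`, `(F, M)` and their tensor product are semistable. -/
theorem statement10 {E F : Type*} [NormedAddCommGroup E] [InnerProductSpace ℝ E]
    [FiniteDimensional ℝ E] [NormedAddCommGroup F] [InnerProductSpace ℝ F]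
    [FiniteDimensional ℝ F] (L : Submodule ℤ E) (M : Submodule ℤ F)
    (hL : IsLat L) (hM : IsLat M)
    (τ : E →ₗ[ℝ] E) (υ : F →ₗ[ℝ] F)
    (hτ : IsIsodual L τ) (hυ : IsIsodual M υ)
    (hτs : ∀ x y, bform τ x y = bform τ y x) (hυs : ∀ x y, bform υ x y = bform υ y x)
    (hτdef : (∀ x : E, x ≠ 0 → 0 < bform τ x x) ∨ (∀ x : E, x ≠ 0 → bform τ x x < 0))
    (hυdef : (∀ y : F, y ≠ 0 → 0 < bform υ y y) ∨ (∀ y : F, y ≠ 0 → bform υ y y < 0)) :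
    Semistable L ∧ Semistable M ∧
    ∀ (G : Type*) [NormedAddCommGroup G] [InnerProductSpace ℝ G]
      (tp : E →ₗ[ℝ] F →ₗ[ℝ] G), IsTensor tp → Semistable (tensorLat tp L M) := by
  obtain ⟨c, hc, hcL, hcL'⟩ := isodual_scalar hτ hτs hτdef
  obtain ⟨d, hd, hdM, hdM'⟩ := isodual_scalar hυ hυs hυdef
  refine ⟨semistable_of_selfDual hL.2 hc hcL hcL', semistable_of_selfDual hM.2 hd hdM hdM', ?_⟩
  intro G _ _ tp htp
  obtain ⟨h1, h2, h3⟩ := tensor_facts hL hM hc hd hcL hdM hcL' hdM' htp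
  haveI : FiniteDimensional ℝ G :=
    Module.Finite.equiv (LinearEquiv.ofBijective _ htp.1)
  exact semistable_of_selfDual h1 (mul_pos hc hd) h2 h3

end EucLat
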